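/- The scalar HK model with n agents terminates in at most 2n³ − 2(n−1)² steps: for any initial condition x(0) ∈ ℝ^n there exists k* ≤ 2n³ − 2(n−1)² such that x(k) = x(k*) for all k ≥ k*. In particular the HK model terminates in O(n³) steps. -/

import Mathlib

open Finset

section HegselmannKrause

variable {ι : Type*} [Fintype ι]

/-- The agents trusted by agent `i` at the opinion profile `y`. -/
noncomputable def hkTrusted (d : ℝ) (y : ι → ℝ) (i : ι) : Finset ι :=
  univ.filter (fun j => |y j - y i| ≤ d)

/-- One step of the Hegselmann–Krause dynamics. -/
noncomputable def hkStep (d : ℝ) (y : ι → ℝ) (i : ι) : ℝ :=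
  (∑ j ∈ hkTrusted d y i, y j) / ((hkTrusted d y i).card : ℝ)

/-- No opinion lies in `[p - d, p)`. -/
def IsBarrierBelow (d : ℝ) (y : ι → ℝ) (p : ℝ) : Prop :=
  ∀ j, p ≤ y j ∨ y j < p - d

/-- No opinion lies in `(q, q + d]`. -/
def IsBarrierAbove (d : ℝ) (y : ι → ℝ) (q : ℝ) : Prop :=
  ∀ j, y j ≤ q ∨ q + d < y j

variable {d : ℝ} {y : ι → ℝ} {i j : ι} {p q c : ℝ}

lemma mem_hkTrusted : j ∈ hkTrusted d y i ↔ y i - d ≤ y j ∧ y j ≤ y i + d := by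
  simp only [hkTrusted, mem_filter, mem_univ, true_and, abs_le]
  constructor <;> rintro ⟨h₁, h₂⟩ <;> constructor <;> linarith

lemma self_mem_hkTrusted (hd : 0 < d) : i ∈ hkTrusted d y i := by
  rw [mem_hkTrusted]; constructor <;> linarith

lemma card_hkTrusted_pos (hd : 0 < d) : (0 : ℝ) < (hkTrusted d y i).card := by
  exact_mod_cast card_pos.2 ⟨i, self_mem_hkTrusted hd⟩

lemma hkStep_le (hd : 0 < d) (h : ∀ j ∈ hkTrusted d y i, y j ≤ c) : hkStep d y i ≤ c := by
  rw [hkStep, div_le_iff₀ (card_hkTrusted_pos hd), mul_comm, ← nsmul_eq_mul]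
  exact sum_le_card_nsmul _ _ _ h

lemma le_hkStep (hd : 0 < d) (h : ∀ j ∈ hkTrusted d y i, c ≤ y j) : c ≤ hkStep d y i := by
  rw [hkStep, le_div_iff₀ (card_hkTrusted_pos hd), mul_comm, ← nsmul_eq_mul]
  exact card_nsmul_le_sum _ _ _ h

lemma hkStep_lt (hd : 0 < d) (h : ∀ j ∈ hkTrusted d y i, y j < c) : hkStep d y i < c := by
  rw [hkStep, div_lt_iff₀ (card_hkTrusted_pos hd), mul_comm, ← nsmul_eq_mul]
  exact (sum_lt_sum_of_nonempty ⟨i, self_mem_hkTrusted hd⟩ h).trans_eq (sum_const c)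

lemma lt_hkStep (hd : 0 < d) (h : ∀ j ∈ hkTrusted d y i, c < y j) : c < hkStep d y i := by
  rw [hkStep, lt_div_iff₀ (card_hkTrusted_pos hd), mul_comm, ← nsmul_eq_mul]
  exact (sum_const c).symm.trans_lt (sum_lt_sum_of_nonempty ⟨i, self_mem_hkTrusted hd⟩ h)

lemma IsBarrierBelow.le_hkStep (hd : 0 < d) (h : IsBarrierBelow d y p) (hi : p ≤ y i) :
    p ≤ hkStep d y i := by
  refine _root_.le_hkStep hd fun j hj => ?_
  rw [mem_hkTrusted] at hj
  rcases h j with h | h <;> linarith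

lemma IsBarrierBelow.hkStep_lt (hd : 0 < d) (h : IsBarrierBelow d y p) (hi : y i < p - d) :
    hkStep d y i < p - d := by
  refine _root_.hkStep_lt hd fun j hj => ?_
  rw [mem_hkTrusted] at hj
  rcases h j with h | h <;> linarith

lemma IsBarrierBelow.step (hd : 0 < d) (h : IsBarrierBelow d y p) :
    IsBarrierBelow d (hkStep d y) p :=
  fun j => (h j).imp (h.le_hkStep hd) (h.hkStep_lt hd)

lemma IsBarrierAbove.hkStep_le (hd : 0 < d) (h : IsBarrierAbove d y q) (hi : y i ≤ q) :
    hkStep d y i ≤ q := by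
  refine _root_.hkStep_le hd fun j hj => ?_
  rw [mem_hkTrusted] at hj
  rcases h j with h | h <;> linarith

lemma IsBarrierAbove.lt_hkStep (hd : 0 < d) (h : IsBarrierAbove d y q) (hi : q + d < y i) :
    q + d < hkStep d y i := by
  refine _root_.lt_hkStep hd fun j hj => ?_
  rw [mem_hkTrusted] at hj
  rcases h j with h | h <;> linarith

lemma IsBarrierAbove.step (hd : 0 < d) (h : IsBarrierAbove d y q) :
    IsBarrierAbove d (hkStep d y) q :=
  fun j => (h j).imp (h.hkStep_le hd) (h.lt_hkStep hd)

lemma card_mul_sum_le_card_mul_sum {α : Type*} {U V : Finset α} {f : α → ℝ}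
    (h : ∀ u ∈ U, ∀ v ∈ V, f u ≤ f v) :
    (V.card : ℝ) * ∑ u ∈ U, f u ≤ U.card * ∑ v ∈ V, f v := by
  have key : ∑ u ∈ U, ∑ _v ∈ V, f u ≤ ∑ u ∈ U, ∑ v ∈ V, f v :=
    sum_le_sum fun u hu => sum_le_sum fun v hv => h u hu v hv
  simpa [mul_sum] using key

/-- The dynamics preserves the order of the opinions. -/
lemma hkStep_mono (hd : 0 < d) (hij : y i ≤ y j) : hkStep d y i ≤ hkStep d y j := by
  classical
  rw [hkStep, hkStep, div_le_div_iff₀ (card_hkTrusted_pos hd) (card_hkTrusted_pos hd)]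
  set S := hkTrusted d y i with hS
  set T := hkTrusted d y j with hT
  have hlow : ∀ u ∈ S \ T, ∀ v ∈ T, y u ≤ y v := fun u hu v hv => by
    simp only [hS, hT, mem_sdiff, mem_hkTrusted, not_and, not_le] at hu hv
    by_contra! hlt
    linarith [hu.2 (by linarith)]
  have hhigh : ∀ u ∈ S, ∀ v ∈ T \ S, y u ≤ y v := fun u hu v hv => by
    simp only [hS, hT, mem_sdiff, mem_hkTrusted, not_and, not_le] at hu hv
    linarith [hv.2 (by linarith)]
  have h₁ := card_mul_sum_le_card_mul_sum (U := S \ T) (V := S ∩ T)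
    fun u hu v hv => hlow u hu v (mem_inter.1 hv).2
  have h₂ := card_mul_sum_le_card_mul_sum (U := S \ T) (V := T \ S)
    fun u hu v hv => hlow u hu v (mem_sdiff.1 hv).1
  have h₃ := card_mul_sum_le_card_mul_sum (U := S ∩ T) (V := T \ S)
    fun u hu v hv => hhigh u (mem_inter.1 hu).1 v hv
  have sS : ∑ u ∈ S ∩ T, y u + ∑ u ∈ S \ T, y u = ∑ u ∈ S, y u := sum_inter_add_sum_sdiff S T y
  have sT : ∑ u ∈ S ∩ T, y u + ∑ u ∈ T \ S, y u = ∑ u ∈ T, y u := by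
    rw [inter_comm]; exact sum_inter_add_sum_sdiff T S y
  have cS : ((S ∩ T).card : ℝ) + (S \ T).card = S.card := by
    exact_mod_cast card_inter_add_card_sdiff S T
  have cT : ((S ∩ T).card : ℝ) + (T \ S).card = T.card := by
    rw [inter_comm]; exact_mod_cast card_inter_add_card_sdiff T S
  rw [← sS, ← sT, ← cS, ← cT]
  nlinarith

/-- A trusted opinion pulls the average up from any lower bound by a `1 / card ι` share. -/
lemma le_card_mul_hkStep_sub (hd : 0 < d) (h : ∀ k ∈ hkTrusted d y i, c ≤ y k)
    (hj : j ∈ hkTrusted d y i) : y j - c ≤ Fintype.card ι * (hkStep d y i - c) := by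
  have hpos := card_hkTrusted_pos (y := y) (i := i) hd
  have hsum : y j - c ≤ ∑ k ∈ hkTrusted d y i, (y k - c) :=
    single_le_sum (f := fun k => y k - c) (fun k hk => sub_nonneg.2 (h k hk)) hj
  have heq : ∑ k ∈ hkTrusted d y i, (y k - c) =
      (hkTrusted d y i).card * (hkStep d y i - c) := by
    rw [sum_sub_distrib, sum_const, nsmul_eq_mul, mul_sub, hkStep, mul_div_cancel₀ _ hpos.ne']
  have hcard : ((hkTrusted d y i).card : ℝ) ≤ Fintype.card ι := by
    exact_mod_cast card_le_univ _
  have := mul_le_mul_of_nonneg_right hcard (sub_nonneg.2 (le_hkStep hd h))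
  linarith

/-- Over two steps, either a barrier below agent `i` advances by `d / (card ι)²`, or the agent
becomes part of an isolated consensus cluster. -/
lemma IsBarrierBelow.exists_advance (hd : 0 < d) (h : IsBarrierBelow d y p) (hi : p ≤ y i) :
    (IsBarrierBelow d (hkStep d y) (hkStep d y i) ∧
      IsBarrierAbove d (hkStep d y) (hkStep d y i)) ∨
    ∃ p', p + d / (Fintype.card ι : ℝ) ^ 2 ≤ p' ∧
      IsBarrierBelow d (hkStep d (hkStep d y)) p' ∧ p' ≤ hkStep d (hkStep d y) i := by
  have hn : (1 : ℝ) ≤ Fintype.card ι := by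
    exact_mod_cast Fintype.card_pos_iff.2 ⟨i⟩
  have hδ : d / (Fintype.card ι : ℝ) ^ 2 ≤ d :=
    div_le_self hd.le (one_le_pow₀ hn)
  obtain ⟨l, hl, hmin⟩ := exists_min_image (univ.filter fun j => p ≤ y j) y
    ⟨i, by simpa using hi⟩
  simp only [mem_filter, mem_univ, true_and] at hl hmin
  set z := hkStep d y with hz
  have hlow : IsBarrierBelow d y (y l) := fun j =>
    (h j).imp (hmin j) fun hj => by linarith
  have hlz : y l ≤ z l := hlow.le_hkStep hd le_rfl
  have hzlow : IsBarrierBelow d z (z l) := fun j =>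
    (h j).imp (fun hj => hkStep_mono hd (hmin j hj)) fun hj => by
      have := h.hkStep_lt hd hj
      linarith
  have hzi : z l ≤ z i := hkStep_mono hd (hmin i hi)
  by_cases hc : y l + d / (Fintype.card ι : ℝ) ^ 2 ≤ hkStep d z l
  · refine Or.inr ⟨hkStep d z l, by linarith, fun j => ?_, hkStep_mono hd hzi⟩
    refine (hzlow j).imp (fun hj => hkStep_mono hd hj) fun hj => ?_
    have := hzlow.hkStep_lt hd hj
    have := hzlow.le_hkStep hd le_rfl
    linarith
  push Not at hc
  have hcluster : ∀ j, z l ≤ z j → z j ≤ z l + d → z j = z l := by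
    intro j hj₁ hj₂
    have hjy : y l ≤ y j := by
      rcases hlow j with hj | hj
      · exact hj
      · have := hlow.hkStep_lt hd hj
        linarith
    have hzj : z j - y l ≤ Fintype.card ι * (hkStep d z l - y l) := by
      refine le_card_mul_hkStep_sub hd (fun k hk => ?_) (mem_hkTrusted.2 ⟨by linarith, hj₂⟩)
      rw [mem_hkTrusted] at hk
      rcases hzlow k with hk' | hk' <;> linarith
    have hge : ∀ k ∈ hkTrusted d y j, y l ≤ y k := fun k hk => by
      rw [mem_hkTrusted] at hk
      rcases hlow k with hk' | hk' <;> linarith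
    have hle : ∀ k ∈ hkTrusted d y j, y k ≤ y l + d := by
      intro k hk
      have hyk := le_card_mul_hkStep_sub hd hge hk
      have hprod : (Fintype.card ι : ℝ) * (Fintype.card ι * (hkStep d z l - y l)) ≤ d := by
        have := (lt_div_iff₀ (by positivity)).1 (show hkStep d z l - y l <
          d / (Fintype.card ι : ℝ) ^ 2 by linarith)
        nlinarith
      have := mul_le_mul_of_nonneg_left hzj (zero_le_one.trans hn)
      change y k - y l ≤ Fintype.card ι * (z j - y l) at hyk
      linarith
    have hjle : y j ≤ y l + d := hle j (self_mem_hkTrusted hd)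
    have hset : hkTrusted d y j = hkTrusted d y l := by
      ext k
      refine ⟨fun hk => ?_, fun hk => ?_⟩
      · rw [mem_hkTrusted]
        exact ⟨by linarith [hge k hk], hle k hk⟩
      · rw [mem_hkTrusted] at hk ⊢
        rcases hlow k with hk' | hk' <;> constructor <;> linarith
    rw [hz, hkStep, hkStep, hset]
  have hzabove : IsBarrierAbove d z (z l) := fun j => by
    by_contra! hj
    linarith [hcluster j hj.1.le hj.2]
  rcases hzabove i with hil | hil
  · have hzil : z i = z l := le_antisymm hil hzi
    rw [hzil]
    exact Or.inl ⟨hzlow, hzabove⟩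
  · obtain ⟨m, hm, hmmin⟩ := exists_min_image (univ.filter fun j => z l + d < z j) z
      ⟨i, by simpa using hil⟩
    simp only [mem_filter, mem_univ, true_and] at hm hmmin
    have hmlow : IsBarrierBelow d z (z m) := fun j =>
      (hzabove j).symm.imp (hmmin j) fun hj => by linarith
    exact Or.inr ⟨z m, by linarith, hmlow.step hd, hmlow.le_hkStep hd (hmmin i hil)⟩

lemma sub_le_card_mul_of_forall_exists_next {a b : ι}
    (h : ∀ c, y a ≤ y c → y c < y b → ∃ e, y c < y e ∧ y e ≤ y c + d) (hd : 0 < d) :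
    y b - y a ≤ (univ.filter fun c => y a ≤ y c ∧ y c < y b).card * d := by
  induction hm : (univ.filter fun c => y a ≤ y c ∧ y c < y b).card using Nat.strong_induction_on
    generalizing a with
  | _ m ih =>
    subst hm
    rcases le_or_gt (y b) (y a) with hab | hab
    · have : (0 : ℝ) ≤ (univ.filter fun c => y a ≤ y c ∧ y c < y b).card * d := by positivity
      linarith
    obtain ⟨e, he, hed⟩ := h a le_rfl hab
    have hlt : (univ.filter fun c => y e ≤ y c ∧ y c < y b).card <
        (univ.filter fun c => y a ≤ y c ∧ y c < y b).card := by
      refine card_lt_card (ssubset_iff_of_subset (fun c hc => ?_) |>.2 ⟨a, ?_, ?_⟩)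
      · simp only [mem_filter, mem_univ, true_and] at hc ⊢
        exact ⟨he.le.trans hc.1, hc.2⟩
      · simpa using hab
      · simpa using fun h' => absurd h' he.not_ge
    have hind := ih _ hlt (fun c hc => h c (he.le.trans hc)) rfl
    have hcast : ((univ.filter fun c => y e ≤ y c ∧ y c < y b).card : ℝ) + 1 ≤
        (univ.filter fun c => y a ≤ y c ∧ y c < y b).card := by exact_mod_cast hlt
    nlinarith

/-- Every agent lies between two barriers at distance at most `(card ι - 1) * d`. -/
lemma exists_barriers (hd : 0 < d) (y : ι → ℝ) (i : ι) :
    ∃ p q, IsBarrierBelow d y p ∧ p ≤ y i ∧ IsBarrierAbove d y q ∧ y i ≤ q ∧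
      q - p ≤ ((Fintype.card ι : ℝ) - 1) * d := by
  classical
  obtain ⟨s, -, hs⟩ := exists_min_image univ y ⟨i, mem_univ i⟩
  obtain ⟨t, -, ht⟩ := exists_max_image univ y ⟨i, mem_univ i⟩
  obtain ⟨a, ha, hamax⟩ := exists_max_image
    (univ.filter fun j => IsBarrierBelow d y (y j) ∧ y j ≤ y i) y
    ⟨s, by simpa using ⟨fun j => Or.inl (hs j (mem_univ j)), hs i (mem_univ i)⟩⟩
  obtain ⟨b, hb, hbmin⟩ := exists_min_image
    (univ.filter fun j => IsBarrierAbove d y (y j) ∧ y i ≤ y j) y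
    ⟨t, by simpa using ⟨fun j => Or.inl (ht j (mem_univ j)), ht i (mem_univ i)⟩⟩
  simp only [mem_filter, mem_univ, true_and] at ha hb hamax hbmin
  refine ⟨y a, y b, ha.1, ha.2, hb.1, hb.2, ?_⟩
  have hnext : ∀ c, y a ≤ y c → y c < y b → ∃ e, y c < y e ∧ y e ≤ y c + d := by
    intro c hac hcb
    by_contra! hno
    have hc : IsBarrierAbove d y (y c) := fun j =>
      (le_or_gt (y j) (y c)).imp_right (hno j)
    rcases le_or_gt (y i) (y c) with hic | hic
    · linarith [hbmin c ⟨hc, hic⟩]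
    · obtain ⟨m, hm, hmmin⟩ := exists_min_image (univ.filter fun j => y c < y j) y
        ⟨i, by simpa using hic⟩
      simp only [mem_filter, mem_univ, true_and] at hm hmmin
      have hmlow : IsBarrierBelow d y (y m) := fun j =>
        (lt_or_ge (y c) (y j)).imp (hmmin j) fun hj => by linarith [hno m hm]
      linarith [hamax m ⟨hmlow, hmmin i hic⟩]
  refine (sub_le_card_mul_of_forall_exists_next hnext hd).trans ?_
  have hcard : (univ.filter fun c => y a ≤ y c ∧ y c < y b).card < Fintype.card ι :=
    card_lt_univ_of_notMem (x := b) (by simp)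
  have : ((univ.filter fun c => y a ≤ y c ∧ y c < y b).card : ℝ) + 1 ≤ Fintype.card ι := by
    exact_mod_cast hcard
  exact mul_le_mul_of_nonneg_right (by linarith) hd.le

variable {x : ℕ → ι → ℝ}

lemma hk_eq_of_isolated (hd : 0 < d) (hx : ∀ k, x (k + 1) = hkStep d (x k)) {t : ℕ}
    (hb : IsBarrierBelow d (x t) (x t i)) (ha : IsBarrierAbove d (x t) (x t i)) {k : ℕ}
    (hk : t ≤ k) : x k i = x t i := by
  suffices IsBarrierBelow d (x k) (x t i) ∧ IsBarrierAbove d (x k) (x t i) ∧ x k i = x t i from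
    this.2.2
  induction k, hk using Nat.le_induction with
  | base => exact ⟨hb, ha, rfl⟩
  | succ k _ ih =>
    obtain ⟨hb', ha', he⟩ := ih
    rw [hx k]
    exact ⟨hb'.step hd, ha'.step hd,
      le_antisymm (ha'.hkStep_le hd he.le) (hb'.le_hkStep hd he.ge)⟩

lemma IsBarrierAbove.le_of_dynamics (hd : 0 < d) (hx : ∀ k, x (k + 1) = hkStep d (x k))
    (h : IsBarrierAbove d (x 0) q) (hi : x 0 i ≤ q) (k : ℕ) : x k i ≤ q := by
  suffices IsBarrierAbove d (x k) q ∧ x k i ≤ q from this.2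
  induction k with
  | zero => exact ⟨h, hi⟩
  | succ k ih =>
    rw [hx k]
    exact ⟨ih.1.step hd, ih.1.hkStep_le hd ih.2⟩

lemma exists_barrier_or_forall_eq (hd : 0 < d) (hx : ∀ k, x (k + 1) = hkStep d (x k))
    (h : IsBarrierBelow d (x 0) p) (hi : p ≤ x 0 i) (m : ℕ) :
    (∀ k, 2 * m ≤ k → x k i = x (2 * m) i) ∨
    ∃ p', p + m * (d / (Fintype.card ι : ℝ) ^ 2) ≤ p' ∧ IsBarrierBelow d (x (2 * m)) p' ∧
      p' ≤ x (2 * m) i := by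
  induction m with
  | zero => exact Or.inr ⟨p, by simp, h, hi⟩
  | succ m ih =>
    rcases ih with hconst | ⟨p₁, hp₁, hb, hle⟩
    · exact Or.inl fun k hk => by rw [hconst k (by lia), hconst (2 * (m + 1)) (by lia)]
    · have hx₂ : x (2 * (m + 1)) = hkStep d (hkStep d (x (2 * m))) := by
        rw [← hx, ← hx]
        rfl
      rcases hb.exists_advance hd hle with ⟨hb', ha'⟩ | ⟨p', hp', hb', hle'⟩
      · rw [← hx] at hb' ha'
        refine Or.inl fun k hk => ?_
        rw [hk_eq_of_isolated hd hx hb' ha' (show 2 * m + 1 ≤ k by lia),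
          hk_eq_of_isolated hd hx hb' ha' (show 2 * m + 1 ≤ 2 * (m + 1) by lia)]
      · rw [hx₂]
        refine Or.inr ⟨p', ?_, hb', hle'⟩
        push_cast
        linarith

/-- Every agent is at rest after `2 (n² (n - 1) + 1)` steps, where `n` is the number of agents. -/
lemma hk_eq_of_le (hd : 0 < d) (hx : ∀ k, x (k + 1) = hkStep d (x k)) (i : ι) {k : ℕ}
    (hk : 2 * (Fintype.card ι ^ 2 * (Fintype.card ι - 1) + 1) ≤ k) :
    x k i = x (2 * (Fintype.card ι ^ 2 * (Fintype.card ι - 1) + 1)) i := by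
  obtain ⟨p, q, hp, hpi, hq, hiq, hpq⟩ := exists_barriers hd (x 0) i
  have hcard : 1 ≤ Fintype.card ι := Fintype.card_pos_iff.2 ⟨i⟩
  rcases exists_barrier_or_forall_eq hd hx hp hpi
    (Fintype.card ι ^ 2 * (Fintype.card ι - 1) + 1) with h | ⟨p', hp', -, hle⟩
  · exact h k hk
  · have hup := hq.le_of_dynamics hd hx hiq (2 * (Fintype.card ι ^ 2 * (Fintype.card ι - 1) + 1))
    push_cast [Nat.cast_sub hcard] at hp'
    have hn : (0 : ℝ) < Fintype.card ι := by exact_mod_cast hcard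
    have hpos : 0 < d / (Fintype.card ι : ℝ) ^ 2 := by positivity
    have heq : ((Fintype.card ι : ℝ) ^ 2 * (Fintype.card ι - 1) + 1) *
        (d / (Fintype.card ι : ℝ) ^ 2) =
        (Fintype.card ι - 1) * d + d / (Fintype.card ι : ℝ) ^ 2 := by
      field_simp
    linarith

end HegselmannKrause

/-- **Cubic termination time of the scalar HK model.**
The scalar HK model with `n` agents terminates in at most
`2n³ − 2(n−1)²` steps; in particular it terminates in `O(n³)` steps. -/
theorem hk_terminates_cubic (n : ℕ) (d : ℝ) (hd : 0 < d)
    (x : ℕ → Fin n → ℝ)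
    (hdyn : ∀ k i, x (k + 1) i =
      (∑ j ∈ univ.filter (fun j => |x k j - x k i| ≤ d), x k j) /
      ((univ.filter (fun j => |x k j - x k i| ≤ d)).card : ℝ)) :
    ∃ kstar : ℕ, kstar ≤ 2 * n ^ 3 - 2 * (n - 1) ^ 2 ∧
      ∀ k, kstar ≤ k → x k = x kstar := by
  have hx : ∀ k, x (k + 1) = hkStep d (x k) := fun k => funext fun i => hdyn k i
  refine ⟨_, le_rfl, fun k hk => funext fun i => ?_⟩
  have hbound : 2 * (n ^ 2 * (n - 1) + 1) ≤ 2 * n ^ 3 - 2 * (n - 1) ^ 2 := by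
    obtain ⟨m, rfl⟩ := Nat.exists_eq_succ_of_ne_zero (Fin.pos i).ne'
    refine Nat.le_sub_of_add_le ?_
    simp only [Nat.succ_eq_add_one, Nat.add_sub_cancel]
    nlinarith
  have hrest : ∀ k, 2 * (n ^ 2 * (n - 1) + 1) ≤ k →
      x k i = x (2 * (n ^ 2 * (n - 1) + 1)) i := fun k hk => by
    simpa using hk_eq_of_le hd hx i (k := k) (by simpa using hk)
  rw [hrest k (hbound.trans hk), hrest _ hbound]
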